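/- Let k be a field of characteristic 0 with derivation ∂, and let u ∈ k be a constant (∂u = 0) such that 1 − n·u ∉ k^† for every integer n, where k^† = {∂d/d : d ∈ k, d ≠ 0}. Let c : ℤ → k be the additive map with c(n) = n·u, and let K_c = k((t^ℤ)) be the Hahn series field with the derivation ∂_c given by (∂_c f)(n) = ∂(f(n)) + n·u·f(n). Then there is no nonzero a ∈ K_c with ∂_c(a) = a, i.e. the equation a^† = 1 has no solution in K_c^×. -/

import Mathlib

/-- Let `k` be a differential field of characteristic 0, `u ∈ k` a
constant with `1 - n·u ∉ k†` for every integer `n`, and let `K_c = k((t^ℤ))` carry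
the derivation `∂_c` with `(∂_c f)(n) = ∂(f n) + n·u·(f n)` (i.e. `c(n) = n·u`).
Then the equation `a† = 1`, i.e. `∂_c a = a`, has no solution `a ∈ K_c^×`. -/
theorem no_logarithmic_derivative_one
    (k : Type*) [Field k] [CharZero k]
    (der : k → k)
    (hder_add : ∀ a b : k, der (a + b) = der a + der b)
    (hder_mul : ∀ a b : k, der (a * b) = a * der b + b * der a)
    (u : k) (hu : der u = 0)
    (hnot : ∀ n : ℤ, ¬ ∃ d : k, d ≠ 0 ∧ (1 : k) - n • u = der d / d)
    (D : HahnSeries ℤ k → HahnSeries ℤ k)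
    (hD : ∀ (f : HahnSeries ℤ k) (n : ℤ),
        (D f).coeff n = der (f.coeff n) + (n • u) * f.coeff n) :
    ¬ ∃ a : HahnSeries ℤ k, a ≠ 0 ∧ D a = a := by
  rintro ⟨a, ha, hDa⟩
  have hd : a.coeff a.order ≠ 0 := HahnSeries.coeff_order_eq_zero.not.mpr ha
  refine hnot a.order ⟨a.coeff a.order, hd, ?_⟩
  have h := hD a a.order
  rw [hDa] at h
  rw [eq_div_iff hd]
  linear_combination h
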